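/- Let d ≥ 3, ε ∈ (0,1), and let S = conv_S{η_1, …, η_d} be a geodesic simplex in S^{d-1} spanned by a strongly ε-separated set {η_1, …, η_d}. Let w be a weight on S^{d-1} with w(S^{d-1}) = 1 and w(B) > 0 for every nonempty spherical cap B, let r ∈ (0,1), and let N be a positive integer such that w(B(x,r)) ≥ 1/N for all x ∈ S^{d-1} and N·w(S) is a positive integer. Then there exist constants c_{d,ε}, c'_{d,ε} > 0 depending only on d and ε, a convex partition {R_1, …, R_n} of S, and points x_1, …, x_n ∈ S such that for every 1 ≤ j ≤ n: N·w(R_j) is a positive integer and B(x_j, c_{d,ε}·r) ⊂ R_j ⊂ B(x_j, c'_{d,ε}·r). -/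

import Mathlib

open MeasureTheory Real Set
open scoped InnerProductSpace

noncomputable section

variable {d : ℕ}

/-- The unit sphere `S^{d-1}` of `ℝ^d`. -/
def unitSphere (d : ℕ) : Set (EuclideanSpace ℝ (Fin d)) :=
  Metric.sphere (0 : EuclideanSpace ℝ (Fin d)) 1

/-- The geodesic distance `dist(x,y) = arccos (x ⬝ y)`. -/
def gdist (x y : EuclideanSpace ℝ (Fin d)) : ℝ := Real.arccos ⟪x, y⟫_ℝ

/-- The spherical cap with center `x` and radius `r`. -/
def cap (x : EuclideanSpace ℝ (Fin d)) (r : ℝ) : Set (EuclideanSpace ℝ (Fin d)) :=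
  {y ∈ unitSphere d | gdist x y ≤ r}

/-- The surface Lebesgue measure on the unit sphere, realized as the
`(d-1)`-dimensional Hausdorff measure restricted to the sphere. -/
def sphMeasure (d : ℕ) : Measure (EuclideanSpace ℝ (Fin d)) :=
  (Measure.hausdorffMeasure ((d : ℝ) - 1)).restrict (unitSphere d)

/-- `w(A) = ∫_A w dσ_d`. -/
def wMass (w : EuclideanSpace ℝ (Fin d) → ℝ) (A : Set (EuclideanSpace ℝ (Fin d))) : ℝ :=
  ∫ x in A, w x ∂(sphMeasure d)

/-- Evaluation of a `d`-variate real polynomial at a point of `ℝ^d`. -/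
def pEval (P : MvPolynomial (Fin d) ℝ) (x : EuclideanSpace ℝ (Fin d)) : ℝ :=
  MvPolynomial.eval (fun i => x i) P

/-- The geodesic arc joining `x` and `y`. -/
def arcSeg (x y : EuclideanSpace ℝ (Fin d)) : Set (EuclideanSpace ℝ (Fin d)) :=
  {z ∈ unitSphere d | ∃ t₁ t₂ : ℝ, 0 ≤ t₁ ∧ 0 ≤ t₂ ∧ z = t₁ • x + t₂ • y}

/-- Geodesic convexity of a subset of the sphere. -/
def GeoConvex (A : Set (EuclideanSpace ℝ (Fin d))) : Prop :=
  ∀ x ∈ A, ∀ y ∈ A, arcSeg x y ⊆ A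

/-- The interior of a subset of the sphere relative to the sphere. -/
def sphInterior (A : Set (EuclideanSpace ℝ (Fin d))) : Set (EuclideanSpace ℝ (Fin d)) :=
  {x ∈ A | ∃ ε : ℝ, 0 < ε ∧ Metric.ball x ε ∩ unitSphere d ⊆ A}

/-- The geodesic simplex spanned by `ξ 0, …, ξ (d-1)`. -/
def geodSimplex (ξ : Fin d → EuclideanSpace ℝ (Fin d)) :
    Set (EuclideanSpace ℝ (Fin d)) :=
  {z | ∃ t : Fin d → ℝ, (∀ j, 0 ≤ t j) ∧ (∑ j, t j) = 1 ∧
    z = ‖∑ j, t j • ξ j‖⁻¹ • ∑ j, t j • ξ j}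

/-- An admissible family `ξ 0, …, ξ (d-1)` of points of the sphere (the indices
`0, 1, …, d-1` correspond to `ξ_1, ξ_2, …, ξ_d` in the paper). -/
def Admissible (ξ : Fin d → EuclideanSpace ℝ (Fin d)) : Prop :=
  LinearIndependent ℝ ξ ∧ (∀ j, ξ j ∈ unitSphere d) ∧
  (∀ i j : Fin d, 1 ≤ (i : ℕ) → 1 ≤ (j : ℕ) → i ≠ j → ⟪ξ i, ξ j⟫_ℝ = 0) ∧
  (∀ i j : Fin d, (i : ℕ) = 0 → (j : ℕ) = 1 →
    Real.arccos ⟪ξ i, ξ j⟫_ℝ ∈ Set.Icc (π / 6) (π / 2)) ∧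
  (∀ i j : Fin d, (i : ℕ) = 0 → 2 ≤ (j : ℕ) → ⟪ξ i, ξ j⟫_ℝ = 0)

/-- A strongly `ε`-separated family of points of the sphere. -/
def StronglySep (ε : ℝ) (η : Fin d → EuclideanSpace ℝ (Fin d)) : Prop :=
  Function.Injective η ∧ (∀ j, η j ∈ unitSphere d) ∧
  ∀ j : Fin d, ∀ y ∈ Submodule.span ℝ (η '' {i | i ≠ j}), ε ≤ ‖η j - y‖

/-- The reflection negating the last coordinate. -/
def lastNeg (d : ℕ) (x : EuclideanSpace ℝ (Fin d)) : EuclideanSpace ℝ (Fin d) :=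
  (EuclideanSpace.equiv (Fin d) ℝ).symm fun i => if (i : ℕ) = d - 1 then -(x i) else x i

/-- The gradient of a `d`-variate polynomial, as a vector of `ℝ^d`. -/
def polyGrad (P : MvPolynomial (Fin d) ℝ) (x : EuclideanSpace ℝ (Fin d)) :
    EuclideanSpace ℝ (Fin d) :=
  (EuclideanSpace.equiv (Fin d) ℝ).symm fun i =>
    MvPolynomial.eval (fun j => x j) (MvPolynomial.pderiv i P)

/-- The tangential gradient `∇₀P(x) = ∇P(x) − (x⬝∇P(x))·x`. -/
def tGrad (P : MvPolynomial (Fin d) ℝ) (x : EuclideanSpace ℝ (Fin d)) :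
    EuclideanSpace ℝ (Fin d) :=
  polyGrad P x - ⟪x, polyGrad P x⟫_ℝ • x

/-- The affine hyperplane through the points `ξ j`. -/
def hplane (ξ : Fin d → EuclideanSpace ℝ (Fin d)) : Set (EuclideanSpace ℝ (Fin d)) :=
  (affineSpan ℝ (Set.range ξ) : Set (EuclideanSpace ℝ (Fin d)))

/-- The ball `B(x,r)_H = {y ∈ H : ‖x − y‖ ≤ r}` in a hyperplane `H`. -/
def ballH (H : Set (EuclideanSpace ℝ (Fin d))) (x : EuclideanSpace ℝ (Fin d)) (r : ℝ) :
    Set (EuclideanSpace ℝ (Fin d)) :=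
  {y ∈ H | ‖x - y‖ ≤ r}

/-- `w(A) = ∫_A w` with respect to `(d−1)`-dimensional Hausdorff (surface) measure. -/
def hMass (w : EuclideanSpace ℝ (Fin d) → ℝ) (A : Set (EuclideanSpace ℝ (Fin d))) : ℝ :=
  ∫ x in A, w x ∂(Measure.hausdorffMeasure ((d : ℝ) - 1))

/-- The interior of `A` relative to a hyperplane `H`. -/
def hInterior (H A : Set (EuclideanSpace ℝ (Fin d))) : Set (EuclideanSpace ℝ (Fin d)) :=
  {x ∈ A | ∃ ε : ℝ, 0 < ε ∧ Metric.ball x ε ∩ H ⊆ A}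

/-- The sum of the coordinates with index below `k`. -/
def headSum (d k : ℕ) : (Fin d → ℝ) →ₗ[ℝ] ℝ :=
  ∑ i ∈ Finset.univ.filter (fun i : Fin d => (i : ℕ) < k), LinearMap.proj i

lemma headSum_apply (k : ℕ) (t : Fin d → ℝ) :
    headSum d k t = ∑ i ∈ Finset.univ.filter (fun i : Fin d => (i : ℕ) < k), t i := by
  simp [headSum, LinearMap.sum_apply]

lemma continuous_headSum (k : ℕ) : Continuous (headSum d k) :=
  LinearMap.continuous_of_finiteDimensional _

lemma headSum_eq_sum (t : Fin d → ℝ) : headSum d d t = ∑ i, t i := by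
  rw [headSum_apply]
  congr 1
  ext i
  simp

lemma filter_lt_succ {k : ℕ} (hk : k < d) :
    (Finset.univ.filter fun i : Fin d => (i : ℕ) < k + 1)
      = insert ⟨k, hk⟩ (Finset.univ.filter fun i : Fin d => (i : ℕ) < k) := by
  ext i
  simp only [Finset.mem_filter, Finset.mem_univ, true_and, Finset.mem_insert, Fin.ext_iff]
  omega

lemma headSum_succ {k : ℕ} (hk : k < d) (t : Fin d → ℝ) :
    headSum d (k + 1) t = headSum d k t + t ⟨k, hk⟩ := by
  rw [headSum_apply, headSum_apply, filter_lt_succ hk, Finset.sum_insert (by simp), add_comm]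

lemma headSum_one (hd : 0 < d) (t : Fin d → ℝ) : headSum d 1 t = t ⟨0, hd⟩ := by
  rw [headSum_succ hd, headSum_apply]
  simp

lemma headSum_nonneg (k : ℕ) {t : Fin d → ℝ} (ht : ∀ i, 0 ≤ t i) : 0 ≤ headSum d k t := by
  rw [headSum_apply]
  exact Finset.sum_nonneg fun i _ => ht i

lemma le_headSum {k : ℕ} {t : Fin d → ℝ} (ht : ∀ i, 0 ≤ t i) {i : Fin d} (hi : (i : ℕ) < k) :
    t i ≤ headSum d k t := by
  rw [headSum_apply]
  exact Finset.single_le_sum (fun j _ => ht j) (by simpa using hi)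

lemma card_filter_lt {k : ℕ} (hk : k ≤ d) :
    (Finset.univ.filter fun i : Fin d => (i : ℕ) < k).card = k := by
  induction k with
  | zero => simp
  | succ k ih =>
    rw [filter_lt_succ hk, Finset.card_insert_of_notMem (by simp), ih (by omega)]

lemma abs_headSum_sub_le {k : ℕ} (hk : k ≤ d) {t p : Fin d → ℝ} {ρ : ℝ}
    (h : ∀ i, |t i - p i| ≤ ρ) : |headSum d k t - headSum d k p| ≤ k * ρ := by
  rw [headSum_apply, headSum_apply, ← Finset.sum_sub_distrib]
  refine (Finset.abs_sum_le_sum_abs _ _).trans ((Finset.sum_le_sum fun i _ => h i).trans ?_)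
  rw [Finset.sum_const, card_filter_lt hk, nsmul_eq_mul]

/-- Closure under nonnegative linear combinations. -/
def IsConvCone {E : Type*} [AddCommGroup E] [Module ℝ E] (K : Set E) : Prop :=
  ∀ x ∈ K, ∀ y ∈ K, ∀ a b : ℝ, 0 ≤ a → 0 ≤ b → a • x + b • y ∈ K

/-- A closed convex cone of positive integral mass whose trace on the standard simplex has
inner radius at least `ρ` and outer radius at most `Λ`. -/
def IsGoodPiece (ν : Measure (Fin d → ℝ)) (ρ Λ : ℝ) (K : Set (Fin d → ℝ)) : Prop :=
  IsClosed K ∧ IsConvCone K ∧ (∃ n : ℕ, 0 < n ∧ ν.real K = n) ∧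
    ∃ p : Fin d → ℝ, (∀ i, 0 ≤ p i) ∧ ∑ i, p i = 1 ∧
      (∀ t : Fin d → ℝ, (∀ i, |t i - p i| ≤ ρ) → t ∈ K) ∧
      ∀ t ∈ K, ∑ i, t i = 1 → ∀ i, |t i - p i| ≤ Λ

/-- `C` is a finite union of good pieces that are pairwise disjoint up to null sets. -/
def HasGoodPartition (ν : Measure (Fin d → ℝ)) (ρ Λ : ℝ) (C : Set (Fin d → ℝ)) : Prop :=
  ∃ F : Finset (Set (Fin d → ℝ)), (∀ K ∈ F, IsGoodPiece ν ρ Λ K) ∧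
    ⋃₀ (F : Set (Set (Fin d → ℝ))) = C ∧
    ∀ K ∈ F, ∀ K' ∈ F, K ≠ K' → ν (K ∩ K') = 0

lemma IsGoodPiece.hasGoodPartition {ν : Measure (Fin d → ℝ)} {ρ Λ : ℝ} {C : Set (Fin d → ℝ)}
    (h : IsGoodPiece ν ρ Λ C) : HasGoodPartition ν ρ Λ C := by
  refine ⟨{C}, by simpa using h, by simp, ?_⟩
  intro K hK K' hK' hne
  rw [Finset.mem_singleton] at hK hK'
  exact absurd (hK.trans hK'.symm) hne

lemma HasGoodPartition.union {ν : Measure (Fin d → ℝ)} {ρ Λ : ℝ} {C₁ C₂ : Set (Fin d → ℝ)}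
    (h₁ : HasGoodPartition ν ρ Λ C₁) (h₂ : HasGoodPartition ν ρ Λ C₂) (h : ν (C₁ ∩ C₂) = 0) :
    HasGoodPartition ν ρ Λ (C₁ ∪ C₂) := by
  classical
  obtain ⟨F₁, hg₁, rfl, hn₁⟩ := h₁
  obtain ⟨F₂, hg₂, rfl, hn₂⟩ := h₂
  have hcross : ∀ K ∈ F₁, ∀ K' ∈ F₂, ν (K ∩ K') = 0 := fun K hK K' hK' =>
    measure_mono_null (inter_subset_inter (subset_sUnion_of_mem (by exact_mod_cast hK))
      (subset_sUnion_of_mem (by exact_mod_cast hK'))) h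
  refine ⟨F₁ ∪ F₂, ?_, by rw [Finset.coe_union, sUnion_union], ?_⟩
  · intro K hK
    rcases Finset.mem_union.1 hK with hK | hK
    exacts [hg₁ K hK, hg₂ K hK]
  · intro K hK K' hK' hne
    rcases Finset.mem_union.1 hK with hK | hK <;> rcases Finset.mem_union.1 hK' with hK' | hK'
    · exact hn₁ K hK K' hK' hne
    · exact hcross K hK K' hK'
    · rw [inter_comm]; exact hcross K' hK' K hK
    · exact hn₂ K hK K' hK' hne

/-- An interval on which `f` grows by at least one over each step of length `h` can be assembled
from intervals of length between `h` and `3h` with integral values of `f` at the endpoints. -/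
lemma interval_induction {f : ℝ → ℝ} (hf : Continuous f) {h : ℝ} (hh : 0 < h)
    {P : ℝ → ℝ → Prop} {a₀ b₀ : ℝ}
    (hgrow : ∀ a b, a₀ ≤ a → b ≤ b₀ → h ≤ b - a → f a + 1 ≤ f b)
    (base : ∀ a b, a₀ ≤ a → b ≤ b₀ → h ≤ b - a → b - a ≤ 3 * h →
      (∃ m : ℤ, f a = m) → (∃ m : ℤ, f b = m) → P a b)
    (glue : ∀ a y b, a₀ ≤ a → a ≤ y → y ≤ b → b ≤ b₀ → P a y → P y b → P a b)
    (hab : h ≤ b₀ - a₀) (ha₀ : ∃ m : ℤ, f a₀ = m) (hb₀ : ∃ m : ℤ, f b₀ = m) : P a₀ b₀ := by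
  have key : ∀ n : ℕ, ∀ a, a₀ ≤ a → h ≤ b₀ - a → b₀ - a ≤ n * h → (∃ m : ℤ, f a = m) →
      P a b₀ := by
    intro n
    induction n with
    | zero =>
      intro a _ h1 h2 _
      simp only [Nat.cast_zero, zero_mul] at h2
      linarith
    | succ n ih =>
      intro a ha h1 h2 hm
      by_cases h3 : b₀ - a ≤ 3 * h
      · exact base a b₀ ha le_rfl h1 h3 hm hb₀
      push Not at h3
      have h4 := hgrow (a + h) (a + 2 * h) (by linarith) (by linarith) (by linarith)
      obtain ⟨y, hy, hfy⟩ : ((⌈f (a + h)⌉ : ℤ) : ℝ) ∈ f '' Icc (a + h) (a + 2 * h) :=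
        intermediate_value_Icc (by linarith) hf.continuousOn
          ⟨Int.le_ceil _, by linarith [Int.ceil_lt_add_one (f (a + h))]⟩
      have hy1 := hy.1
      have hy2 := hy.2
      push_cast at h2
      refine glue a y b₀ ha (by linarith) (by linarith) le_rfl
        (base a y ha (by linarith) (by linarith) (by linarith) hm ⟨_, hfy⟩)
        (ih y (by linarith) (by linarith) (by linarith) ⟨_, hfy⟩)
  obtain ⟨n, hn⟩ := exists_nat_ge ((b₀ - a₀) / h)
  exact key n a₀ le_rfl hab ((div_le_iff₀ hh).1 hn) ha₀

/-- The mass below a level is continuous in the level if all level sets are null. -/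
lemma continuous_measureReal_inter_le {E : Type*} [MeasurableSpace E] (ν : Measure E)
    [IsFiniteMeasure ν] {C : Set E} (hC : MeasurableSet C) {u v : E → ℝ}
    (hu : Measurable u) (hv : Measurable v) (hnull : ∀ x : ℝ, ν {t | u t = x * v t} = 0) :
    Continuous fun x : ℝ => ν.real (C ∩ {t | u t ≤ x * v t}) := by
  classical
  have hm : ∀ x : ℝ, MeasurableSet (C ∩ {t | u t ≤ x * v t}) := fun x =>
    hC.inter (measurableSet_le hu (hv.const_mul x))
  have heq : (fun x : ℝ => ν.real (C ∩ {t | u t ≤ x * v t}))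
      = fun x => ∫ t, (C ∩ {t | u t ≤ x * v t}).indicator (fun _ => (1 : ℝ)) t ∂ν := by
    funext x
    rw [integral_indicator_const _ (hm x)]
    simp
  rw [heq, continuous_iff_continuousAt]
  intro x₀
  refine continuousAt_of_dominated (bound := fun _ => (1 : ℝ)) ?_ ?_ (integrable_const _) ?_
  · exact Filter.Eventually.of_forall fun x =>
      (measurable_const.indicator (hm x)).aestronglyMeasurable
  · refine Filter.Eventually.of_forall fun x => Filter.Eventually.of_forall fun t => ?_
    by_cases ht : t ∈ C ∩ {t | u t ≤ x * v t} <;> simp [ht]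
  · have hae : ∀ᵐ t ∂ν, u t ≠ x₀ * v t := by
      rw [ae_iff]
      simpa using hnull x₀
    filter_upwards [hae] with t ht
    have hcont : Continuous fun x : ℝ => x * v t := continuous_id.mul continuous_const
    refine ContinuousAt.congr (f := fun _ => (C ∩ {t | u t ≤ x₀ * v t}).indicator
      (fun _ => (1 : ℝ)) t) continuousAt_const ?_
    rcases lt_or_gt_of_ne ht with h | h
    · filter_upwards [hcont.continuousAt.eventually (lt_mem_nhds h)] with x hx
      have hx' : u t < x * v t := hx
      simp only [indicator]
      exact if_congr (and_congr_right fun _ => iff_of_true h.le hx'.le) rfl rfl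
    · filter_upwards [hcont.continuousAt.eventually (gt_mem_nhds h)] with x hx
      have hx' : x * v t < u t := hx
      simp only [indicator]
      exact if_congr (and_congr_right fun _ => iff_of_false h.not_ge hx'.not_ge) rfl rfl

/-- A closed convex cone `C` in the orthant that restricts, near the center `p`, only the sum of
the first `k` coordinates and the remaining coordinates: the restrictions are satisfied within
`α` of `p` and confine the points of `C` in the standard simplex to within `β` of `p`. -/
structure IsCell (k : ℕ) (α β : ℝ) (C : Set (Fin d → ℝ)) (p : Fin d → ℝ) : Prop where
  closed : IsClosed C
  cone : IsConvCone C
  nonneg : ∀ t ∈ C, ∀ i, 0 ≤ t i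
  sum_eq : ∑ i, p i = 1
  le_center : ∀ i, α / d ≤ p i
  inner : ∀ t : Fin d → ℝ, (∀ i, 0 ≤ t i) → |headSum d k t - headSum d k p| ≤ α →
    (∀ i : Fin d, k ≤ (i : ℕ) → |t i - p i| ≤ α) → t ∈ C
  outer_head : ∀ t ∈ C, ∑ i, t i = 1 → |headSum d k t - headSum d k p| ≤ β
  outer_tail : ∀ t ∈ C, ∑ i, t i = 1 → ∀ i : Fin d, k ≤ (i : ℕ) → |t i - p i| ≤ β

lemma IsCell.box_subset {k : ℕ} {α β : ℝ} {C : Set (Fin d → ℝ)} {p : Fin d → ℝ}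
    (h : IsCell k α β C p) (hd : 0 < d) (hk : k ≤ d) (hα : 0 ≤ α) {t : Fin d → ℝ}
    (ht : ∀ i, |t i - p i| ≤ α / d) : t ∈ C := by
  have hd' : (1 : ℝ) ≤ d := by exact_mod_cast hd
  refine h.inner t (fun i => ?_) ?_ fun i _ => (ht i).trans (div_le_self hα hd')
  · linarith [(abs_le.1 (ht i)).1, h.le_center i]
  · refine (abs_headSum_sub_le hk ht).trans ?_
    rw [mul_div_assoc', div_le_iff₀ (by linarith), mul_comm]
    exact mul_le_mul_of_nonneg_left (by exact_mod_cast hk) hα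

/-- The part of `C` where the fraction of coordinate `k` in the first `k + 1` coordinates lies
in `[a, b]`. -/
def slab (k : Fin d) (C : Set (Fin d → ℝ)) (a b : ℝ) : Set (Fin d → ℝ) :=
  C ∩ {t | a * headSum d (k + 1) t ≤ t k ∧ t k ≤ b * headSum d (k + 1) t}

/-- The center of a slab: `a` fraction `x` of the head sum goes to coordinate `k`, and the rest
is distributed evenly. -/
def slabCenter (k : Fin d) (p : Fin d → ℝ) (x : ℝ) (i : Fin d) : ℝ :=
  if (i : ℕ) < k then headSum d (k + 1) p * (1 - x) / k
  else if i = k then headSum d (k + 1) p * x else p i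

lemma headSum_slabCenter {k : Fin d} (hk : 1 ≤ (k : ℕ)) (p : Fin d → ℝ) (x : ℝ) :
    headSum d k (slabCenter k p x) = headSum d (k + 1) p * (1 - x) := by
  have hk' : ((k : ℕ) : ℝ) ≠ 0 := by positivity
  rw [headSum_apply, Finset.sum_congr rfl (g := fun _ => headSum d (k + 1) p * (1 - x) / k),
    Finset.sum_const, card_filter_lt k.2.le, nsmul_eq_mul]
  · field_simp
  · intro i hi
    simp only [Finset.mem_filter, Finset.mem_univ, true_and] at hi
    simp [slabCenter, hi]

lemma slabCenter_self (k : Fin d) (p : Fin d → ℝ) (x : ℝ) :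
    slabCenter k p x k = headSum d (k + 1) p * x := by
  simp [slabCenter]

lemma slabCenter_of_lt {k i : Fin d} (hi : k < i) (p : Fin d → ℝ) (x : ℝ) :
    slabCenter k p x i = p i := by
  have h1 : ¬ (i : ℕ) < k := by have : (k : ℕ) < i := hi; omega
  simp [slabCenter, h1, hi.ne']

lemma sum_slabCenter {k : Fin d} (hk : 1 ≤ (k : ℕ)) (p : Fin d → ℝ) (x : ℝ) :
    ∑ i, slabCenter k p x i = ∑ i, p i := by
  have h : ∀ t : Fin d → ℝ, ∑ i, t i
      = headSum d (k + 1) t + ∑ i ∈ Finset.univ.filter (fun i : Fin d => ¬ (i : ℕ) < k + 1), t i := fun t => by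
    rw [headSum_apply, Finset.sum_filter_add_sum_filter_not]
  rw [h, h p, headSum_succ k.2, headSum_slabCenter hk, Fin.eta, slabCenter_self]
  congr 1
  · ring
  · refine Finset.sum_congr rfl fun i hi => slabCenter_of_lt ?_ p x
    simp only [Finset.mem_filter, Finset.mem_univ, true_and, not_lt] at hi
    exact hi

lemma abs_mul_sub_mul_le {c u v e : ℝ} (hc : 0 ≤ c) (hc' : c ≤ 1) (h : |u - v| ≤ e) :
    |c * u - c * v| ≤ e := by
  rw [← mul_sub, abs_mul, abs_of_nonneg hc]
  exact (mul_le_of_le_one_left (abs_nonneg _) hc').trans h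

lemma IsCell.isCell_slab {k : Fin d} (hk : 1 ≤ (k : ℕ)) {α β ω : ℝ} {C : Set (Fin d → ℝ)}
    {p : Fin d → ℝ} (h : IsCell (k + 1) (2 * α) β C p) (hα : 0 ≤ α) (hω : 6 * α ≤ ω)
    {a b : ℝ} (ha : 0 ≤ a) (hle : a ≤ b) (hb : b ≤ 1) (hab : ω ≤ headSum d (k + 1) p * (b - a))
    (hab' : headSum d (k + 1) p * (b - a) ≤ 3 * ω) :
    IsCell k α (β + 2 * ω) (slab k C a b) (slabCenter k p ((a + b) / 2)) := by
  have hp : ∀ i, 0 ≤ p i := fun i => (div_nonneg (by linarith) (by positivity)).trans (h.le_center i)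
  have hσ := headSum_nonneg (k + 1) hp
  set σ := headSum d (k + 1) p with hσdef
  have hhead := headSum_slabCenter hk p ((a + b) / 2)
  have hself := slabCenter_self k p ((a + b) / 2)
  rw [← hσdef] at hhead hself
  have hsa : 0 ≤ σ * a := mul_nonneg hσ ha
  have hsb : σ * b ≤ σ := mul_le_of_le_one_right hσ hb
  have hk' : (1 : ℝ) ≤ ((k : ℕ) : ℝ) := by exact_mod_cast hk
  have hkd : ((k : ℕ) : ℝ) ≤ d := by exact_mod_cast k.2.le
  have hc := continuous_headSum (d := d) (k + 1)
  have hd1 : α / d ≤ α := div_le_self hα (hk'.trans hkd)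
  refine ⟨?_, ?_, fun t ht => h.nonneg t ht.1, ?_, ?_, ?_, ?_, ?_⟩
  · exact h.closed.inter ((isClosed_le (continuous_const.mul hc) (continuous_apply k)).inter
      (isClosed_le (continuous_apply k) (continuous_const.mul hc)))
  · rintro x ⟨hx, hx1, hx2⟩ y ⟨hy, hy1, hy2⟩ u v hu hv
    refine ⟨h.cone x hx y hy u v hu hv, ?_, ?_⟩ <;>
      simp only [map_add, map_smul, smul_eq_mul, Pi.add_apply, Pi.smul_apply]
    · nlinarith [mul_le_mul_of_nonneg_left hx1 hu, mul_le_mul_of_nonneg_left hy1 hv]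
    · nlinarith [mul_le_mul_of_nonneg_left hx2 hu, mul_le_mul_of_nonneg_left hy2 hv]
  · rw [sum_slabCenter hk, h.sum_eq]
  · intro i
    rcases lt_trichotomy i k with hi | rfl | hi
    · have hi' : (i : ℕ) < k := hi
      simp only [slabCenter, hi', if_true, ← hσdef]
      have : α ≤ σ * (1 - (a + b) / 2) := by linarith
      calc α / d ≤ α / (k : ℕ) := div_le_div_of_nonneg_left hα (by linarith) hkd
        _ ≤ _ := div_le_div_of_nonneg_right this (by linarith)
    · rw [hself]
      linarith
    · rw [slabCenter_of_lt hi]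
      exact (div_le_div_of_nonneg_right (by linarith) (by positivity)).trans (h.le_center i)
  · intro t ht h1 h2
    have h3 := h2 k le_rfl
    rw [hself] at h3
    rw [hhead] at h1
    have hS : |headSum d (k + 1) t - σ| ≤ 2 * α := by
      rw [headSum_succ k.2, Fin.eta]
      rw [abs_le] at h1 h3 ⊢
      constructor <;> linarith
    have h4 := abs_le.1 hS
    have h3' := abs_le.1 h3
    refine ⟨h.inner t ht hS fun i hi => ?_, ?_, ?_⟩
    · have := h2 i (by omega)
      rw [slabCenter_of_lt (show (k : ℕ) < i from hi)] at this
      linarith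
    · linarith [(abs_le.1 (abs_mul_sub_mul_le ha (hle.trans hb) hS)).2]
    · linarith [(abs_le.1 (abs_mul_sub_mul_le (ha.trans hle) hb hS)).1]
  · rintro t ⟨ht, h1, h2⟩ hs
    have h3 := h.outer_head t ht hs
    rw [← hσdef] at h3
    have h4 := abs_le.1 (abs_mul_sub_mul_le ha (hle.trans hb) h3)
    have h5 := abs_le.1 (abs_mul_sub_mul_le (ha.trans hle) hb h3)
    have h6 := abs_le.1 (abs_mul_sub_mul_le (c := 1 - a) (by linarith) (by linarith) h3)
    have h7 := abs_le.1 (abs_mul_sub_mul_le (c := 1 - b) (by linarith) (by linarith) h3)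
    have hS := headSum_succ k.2 t
    rw [Fin.eta] at hS
    rw [hhead, abs_le]
    constructor <;> linarith
  · rintro t ⟨ht, h1, h2⟩ hs i hi
    have h3 := h.outer_head t ht hs
    rw [← hσdef] at h3
    have h4 := abs_le.1 (abs_mul_sub_mul_le ha (hle.trans hb) h3)
    have h5 := abs_le.1 (abs_mul_sub_mul_le (ha.trans hle) hb h3)
    have h6 := abs_le.1 (abs_mul_sub_mul_le (c := 1 - a) (by linarith) (by linarith) h3)
    have h7 := abs_le.1 (abs_mul_sub_mul_le (c := 1 - b) (by linarith) (by linarith) h3)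
    rcases hi.lt_or_eq with hi | hi
    · rw [slabCenter_of_lt (show (k : ℕ) < i from hi)]
      linarith [h.outer_tail t ht hs i hi]
    · obtain rfl : k = i := Fin.ext hi
      rw [hself, abs_le]
      constructor <;> linarith

lemma slab_union {k : Fin d} {C : Set (Fin d → ℝ)} (hC : ∀ t ∈ C, ∀ i, 0 ≤ t i) {a y b : ℝ}
    (hay : a ≤ y) (hyb : y ≤ b) : slab k C a y ∪ slab k C y b = slab k C a b := by
  ext t
  constructor
  · rintro (⟨ht, h1, h2⟩ | ⟨ht, h1, h2⟩) <;>
      have hS := headSum_nonneg ((k : ℕ) + 1) (hC t ht)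
    · exact ⟨ht, h1, h2.trans (mul_le_mul_of_nonneg_right hyb hS)⟩
    · exact ⟨ht, (mul_le_mul_of_nonneg_right hay hS).trans h1, h2⟩
  · rintro ⟨ht, h1, h2⟩
    rcases le_total (t k) (y * headSum d (k + 1) t) with h | h
    exacts [Or.inl ⟨ht, h1, h⟩, Or.inr ⟨ht, h, h2⟩]

lemma slab_zero_one {k : Fin d} {C : Set (Fin d → ℝ)} (hC : ∀ t ∈ C, ∀ i, 0 ≤ t i) :
    slab k C 0 1 = C := by
  refine inter_eq_left.2 fun t ht => ⟨?_, ?_⟩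
  · rw [zero_mul]
    exact hC t ht k
  · rw [one_mul]
    exact le_headSum (hC t ht) (Nat.lt_succ_self _)

/-- Every linear hyperplane is null. -/
def NullHyperplanes {E : Type*} [AddCommGroup E] [Module ℝ E] [MeasurableSpace E]
    (ν : Measure E) : Prop :=
  ∀ u : E →ₗ[ℝ] ℝ, u ≠ 0 → ν {t | u t = 0} = 0

lemma NullHyperplanes.level {ν : Measure (Fin d → ℝ)} (hν : NullHyperplanes ν) {k : Fin d}
    (hk : 1 ≤ (k : ℕ)) (x : ℝ) : ν {t | t k = x * headSum d (k + 1) t} = 0 := by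
  have h := hν (LinearMap.proj k - x • headSum d (k + 1)) fun h0 => by
    have hk0 : (⟨0, by omega⟩ : Fin d) ≠ k := fun h => by
      have := congrArg Fin.val h
      simp only at this
      omega
    have h1 := LinearMap.congr_fun h0 (Pi.single k 1)
    have h2 := LinearMap.congr_fun h0 (Pi.single ⟨0, by omega⟩ 1)
    simp only [headSum_apply, LinearMap.sub_apply, LinearMap.smul_apply, LinearMap.proj_apply,
      smul_eq_mul, LinearMap.zero_apply, Pi.single_apply, Finset.sum_ite_eq', Finset.mem_filter,
      Finset.mem_univ, true_and, hk0.symm, if_true, if_false] at h1 h2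
    simp at h1 h2
    linarith
  simpa [sub_eq_zero] using h

lemma measureReal_slab {ν : Measure (Fin d → ℝ)} [IsFiniteMeasure ν] (hν : NullHyperplanes ν)
    {k : Fin d} (hk : 1 ≤ (k : ℕ)) {C : Set (Fin d → ℝ)} (hCm : MeasurableSet C)
    (hC : ∀ t ∈ C, ∀ i, 0 ≤ t i) {a b : ℝ} (hab : a ≤ b) :
    ν.real (slab k C a b) = ν.real (C ∩ {t | t k ≤ b * headSum d (k + 1) t})
      - ν.real (C ∩ {t | t k ≤ a * headSum d (k + 1) t}) := by
  have hS : Measurable (headSum d ((k : ℕ) + 1)) := (continuous_headSum _).measurable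
  have hu : C ∩ {t | t k ≤ b * headSum d (k + 1) t}
      = slab k C a b ∪ (C ∩ {t | t k ≤ a * headSum d (k + 1) t}) := by
    ext t
    constructor
    · rintro ⟨ht, h⟩
      rcases le_total (t k) (a * headSum d (k + 1) t) with h' | h'
      exacts [Or.inr ⟨ht, h'⟩, Or.inl ⟨ht, h', h⟩]
    · rintro (⟨ht, -, h⟩ | ⟨ht, h⟩)
      · exact ⟨ht, h⟩
      · exact ⟨ht, le_trans h (mul_le_mul_of_nonneg_right hab (headSum_nonneg _ (hC t ht)))⟩
  rw [hu, measureReal_union₀]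
  · ring
  · exact (hCm.inter (measurableSet_le (measurable_pi_apply k)
      (hS.const_mul a))).nullMeasurableSet
  · refine measure_mono_null ?_ (hν.level hk a)
    rintro t ⟨⟨-, h1, -⟩, ⟨-, h2⟩⟩
    exact le_antisymm h2 h1

lemma slab_inter_null {ν : Measure (Fin d → ℝ)} (hν : NullHyperplanes ν) {k : Fin d}
    (hk : 1 ≤ (k : ℕ)) (C : Set (Fin d → ℝ)) (a y b : ℝ) :
    ν (slab k C a y ∩ slab k C y b) = 0 := by
  refine measure_mono_null ?_ (hν.level hk y)
  rintro t ⟨⟨-, -, h1⟩, ⟨-, h2, -⟩⟩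
  exact le_antisymm h1 h2

/-- Every cone containing a box of radius `δ` around a point of the standard simplex has mass at
least one. -/
def BoxMass (ν : Measure (Fin d → ℝ)) (δ : ℝ) : Prop :=
  ∀ p : Fin d → ℝ, (∀ i, 0 ≤ p i) → ∑ i, p i = 1 → ∀ K : Set (Fin d → ℝ), IsClosed K →
    IsConvCone K → (∀ t : Fin d → ℝ, (∀ i, |t i - p i| ≤ δ) → t ∈ K) → 1 ≤ ν.real K

lemma IsCell.one_le_measure {ν : Measure (Fin d → ℝ)} {δ : ℝ} (hν : BoxMass ν δ) {k : ℕ}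
    {α β : ℝ} {C : Set (Fin d → ℝ)} {p : Fin d → ℝ} (h : IsCell k α β C p) (hd : 0 < d)
    (hk : k ≤ d) (hα : 0 ≤ α) (hδ : δ ≤ α / d) : 1 ≤ ν.real C :=
  hν p (fun i => (div_nonneg hα (by positivity)).trans (h.le_center i)) h.sum_eq C h.closed h.cone
    fun _ ht => h.box_subset hd hk hα fun i => (ht i).trans hδ

lemma IsCell.isGoodPiece {ν : Measure (Fin d → ℝ)} {k : ℕ} {α β ρ Λ : ℝ}
    {C : Set (Fin d → ℝ)} {p : Fin d → ℝ} (h : IsCell k α β C p) (hd : 0 < d) (hk : k ≤ d)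
    (hα : 0 ≤ α) (hρ : ρ ≤ α / d) (hm : ∃ n : ℕ, 0 < n ∧ ν.real C = n)
    (hΛ : β ≤ Λ) (hsmall : k = 1 ∨ headSum d k p + β ≤ Λ) : IsGoodPiece ν ρ Λ C := by
  have hp : ∀ i, 0 ≤ p i := fun i => (div_nonneg hα (by positivity)).trans (h.le_center i)
  refine ⟨h.closed, h.cone, hm, p, hp, h.sum_eq,
    fun t ht => h.box_subset hd hk hα fun i => (ht i).trans hρ, fun t ht hs i => ?_⟩
  rcases le_or_gt k i with hi | hi
  · exact (h.outer_tail t ht hs i hi).trans hΛ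
  have h1 := h.outer_head t ht hs
  rcases hsmall with rfl | hsmall
  · rw [headSum_one hd, headSum_one hd] at h1
    obtain rfl : i = ⟨0, hd⟩ := Fin.ext (show (i : ℕ) = 0 by omega)
    exact h1.trans hΛ
  · have h2 := le_headSum (h.nonneg t ht) hi
    have h3 := le_headSum hp hi
    have h4 := h.nonneg t ht i
    have h5 := hp i
    rw [abs_le] at h1 ⊢
    constructor <;> linarith

lemma IsCell.hasGoodPartition {ν : Measure (Fin d → ℝ)} [IsFiniteMeasure ν]
    (hν : NullHyperplanes ν) {δ : ℝ} (hδ : 0 < δ) (hbox : BoxMass ν δ) {k : ℕ} (hk1 : 1 ≤ k)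
    (hk : k ≤ d) {C : Set (Fin d → ℝ)} {p : Fin d → ℝ}
    (h : IsCell k (d * 2 ^ k * δ) (2 * (6 * d * 2 ^ d) * (d - k) * δ) C p)
    (hm : ∃ n : ℕ, 0 < n ∧ ν.real C = n) :
    HasGoodPartition ν δ (6 * d * 2 ^ d * (2 * d + 1) * δ) C := by
  have hd : 0 < d := by omega
  have hd' : (0 : ℝ) < d := by exact_mod_cast hd
  set ω : ℝ := 6 * d * 2 ^ d with hω
  have hω0 : 0 < ω := by positivity
  have hin : ∀ j : ℕ, δ ≤ d * 2 ^ j * δ / d := fun j => by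
    rw [mul_assoc, mul_div_cancel_left₀ _ hd'.ne']
    exact le_mul_of_one_le_left hδ.le (one_le_pow₀ (by norm_num))
  have hout : ∀ j : ℕ, 2 * ω * (d - j) * δ + ω * δ ≤ ω * (2 * d + 1) * δ := fun j => by
    have : 0 ≤ 2 * ω * j * δ := by positivity
    linarith
  have hωδ : 0 < ω * δ := by positivity
  induction k, hk1 using Nat.le_induction generalizing C p with
  | base =>
    exact (h.isGoodPiece hd hk (by positivity) (hin 1) hm (by linarith [hout 1])
      (Or.inl rfl)).hasGoodPartition
  | succ k hk1 ih =>
    by_cases hsmall : headSum d (k + 1) p ≤ ω * δ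
    · exact (h.isGoodPiece hd hk (by positivity) (hin _) hm (by linarith [hout (k + 1)])
        (Or.inr (by linarith [hout (k + 1)]))).hasGoodPartition
    push Not at hsmall
    lift k to Fin d using hk
    set σ := headSum d (k + 1) p with hσdef
    have hσ : 0 < σ := by linarith
    have hαω : 6 * (d * 2 ^ (k : ℕ) * δ) ≤ ω * δ := by
      have : (2 : ℝ) ^ (k : ℕ) ≤ 2 ^ d := pow_le_pow_right₀ (by norm_num) k.2.le
      rw [hω]
      have := mul_le_mul_of_nonneg_left this (show 0 ≤ 6 * d * δ by positivity)
      linarith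
    have h' : IsCell (k + 1) (2 * (d * 2 ^ (k : ℕ) * δ)) (2 * ω * (d - ((k : ℕ) + 1)) * δ) C p := by
      convert h using 1
      · ring
      · push_cast
        ring
    have hcell : ∀ a b : ℝ, 0 ≤ a → b ≤ 1 → ω * δ / σ ≤ b - a → b - a ≤ 3 * (ω * δ / σ) →
        IsCell k (d * 2 ^ (k : ℕ) * δ) (2 * ω * (d - (k : ℕ)) * δ) (slab k C a b)
          (slabCenter k p ((a + b) / 2)) := by
      intro a b ha hb h1 h2
      have h0 : 0 < ω * δ / σ := by positivity
      have := h'.isCell_slab hk1 (by positivity) hαω ha (by linarith) hb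
        (by rw [div_le_iff₀ hσ] at h1; linarith)
        (by rw [← mul_div_assoc, le_div_iff₀ hσ] at h2; linarith)
      convert this using 1
      ring
    set f : ℝ → ℝ := fun x => ν.real (C ∩ {t | t k ≤ x * headSum d (k + 1) t}) with hf
    have hmass : ∀ a b : ℝ, a ≤ b → ν.real (slab k C a b) = f b - f a := fun a b hab =>
      measureReal_slab hν hk1 h.closed.measurableSet h.nonneg hab
    have hmono : Monotone f := fun a b hab => by
      have := hmass a b hab
      have := measureReal_nonneg (μ := ν) (s := slab k C a b)
      linarith
    have h0 : 0 < ω * δ / σ := by positivity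
    have h1 : ω * δ / σ ≤ 1 := by rw [div_le_one hσ]; exact hsmall.le
    have hgrow : ∀ a b, 0 ≤ a → b ≤ 1 → ω * δ / σ ≤ b - a → f a + 1 ≤ f b := by
      intro a b ha hb hab
      have := (hcell a (a + ω * δ / σ) ha (by linarith) (by linarith)
        (by linarith)).one_le_measure hbox hd k.2.le (by positivity) (hin k)
      rw [hmass _ _ (by linarith)] at this
      linarith [hmono (show a + ω * δ / σ ≤ b by linarith)]
    have hf0 : f 0 = 0 := by
      refine measureReal_mono_null (s₂ := {t | t k = 0 * headSum d (k + 1) t}) ?_ ?_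
      · rintro t ⟨ht, h2⟩
        simp only [zero_mul, mem_ofPred_eq] at h2 ⊢
        exact le_antisymm h2 (h.nonneg t ht k)
      · rw [Measure.real, hν.level hk1 0, ENNReal.toReal_zero]
    have hf1 : f 1 = ν.real C := by
      have := hmass 0 1 zero_le_one
      rw [slab_zero_one h.nonneg] at this
      linarith
    rw [← slab_zero_one (k := k) h.nonneg]
    refine interval_induction (P := fun a b => HasGoodPartition ν δ (ω * (2 * d + 1) * δ)
      (slab k C a b)) (continuous_measureReal_inter_le ν h.closed.measurableSet
        (measurable_pi_apply k) (continuous_headSum _).measurable (hν.level hk1)) h0 hgrow ?_ ?_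
      (by linarith) ⟨0, by rw [Int.cast_zero]; exact hf0⟩ ?_
    · rintro a b ha hb h2 h3 ⟨m, hma⟩ ⟨n, hnb⟩
      refine ih k.2.le ⟨(n - m).toNat, ?_, ?_⟩ (hcell a b ha hb h2 h3)
      · have := hgrow a b ha hb h2
        simp only [hf] at this
        rw [hma, hnb] at this
        have : m + 1 ≤ n := by exact_mod_cast this
        omega
      · have h4 := hgrow a b ha hb h2
        rw [hmass a b (by linarith)]
        simp only [hf] at h4 ⊢
        rw [hma, hnb] at h4 ⊢
        have : m + 1 ≤ n := by exact_mod_cast h4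
        have : ((n - m).toNat : ℤ) = n - m := Int.toNat_of_nonneg (by omega)
        exact_mod_cast this.symm
    · intro a y b _ hay hyb _ hP hQ
      rw [← slab_union h.nonneg hay hyb]
      exact hP.union hQ (slab_inter_null hν hk1 C a y b)
    · obtain ⟨n, -, hn⟩ := hm
      exact ⟨n, by rw [hn] at hf1; exact_mod_cast hf1⟩

/-- The nonnegative orthant has a good partition at every scale. -/
lemma hasGoodPartition_orthant {ν : Measure (Fin d → ℝ)} [IsFiniteMeasure ν]
    (hν : NullHyperplanes ν) (hd : 0 < d) {δ : ℝ} (hδ : 0 < δ) (hbox : BoxMass ν δ)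
    (hm : ∃ n : ℕ, 0 < n ∧ ν.real {t : Fin d → ℝ | ∀ i, 0 ≤ t i} = n) :
    HasGoodPartition ν (min δ (1 / d)) (6 * d * 2 ^ d * (2 * d + 1) * δ)
      {t : Fin d → ℝ | ∀ i, 0 ≤ t i} := by
  have hd' : (0 : ℝ) < d := by exact_mod_cast hd
  have hsum : ∑ _i : Fin d, (1 / d : ℝ) = 1 := by
    simp [hd'.ne']
  have hclosed : IsClosed {t : Fin d → ℝ | ∀ i, 0 ≤ t i} := by
    simp only [ofPred_forall]
    exact isClosed_iInter fun i => isClosed_le continuous_const (continuous_apply i)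
  have hcone : IsConvCone {t : Fin d → ℝ | ∀ i, 0 ≤ t i} := fun x hx y hy a b ha hb i =>
    add_nonneg (mul_nonneg ha (hx i)) (mul_nonneg hb (hy i))
  have h2 : (1 : ℝ) ≤ 2 ^ d := one_le_pow₀ (by norm_num)
  by_cases hα : d * 2 ^ d * δ ≤ 1
  · have hδd : δ ≤ 1 / d := by
      rw [le_div_iff₀ hd']
      nlinarith [mul_pos hδ hd']
    rw [min_eq_left hδd]
    have hcell : IsCell d (d * 2 ^ d * δ) 0 {t : Fin d → ℝ | ∀ i, 0 ≤ t i} fun _ => 1 / d :=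
      { closed := hclosed
        cone := hcone
        nonneg := fun t ht => ht
        sum_eq := hsum
        le_center := fun i => div_le_div_of_nonneg_right hα hd'.le
        inner := fun t ht _ _ => ht
        outer_head := fun t _ hs => by rw [headSum_eq_sum, headSum_eq_sum, hs, hsum]; simp
        outer_tail := fun t _ _ i hi => absurd i.2 (by omega) }
    refine IsCell.hasGoodPartition hν hδ hbox hd le_rfl (p := fun _ => 1 / d) ?_ hm
    simpa using hcell
  · push Not at hα
    refine IsGoodPiece.hasGoodPartition ⟨hclosed, hcone, hm, fun _ => 1 / d,
      fun _ => by positivity, hsum, fun t ht i => ?_, fun t ht hs i => ?_⟩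
    · linarith [(abs_le.1 ((ht i).trans (min_le_right _ _))).1]
    · have h1 : t i ≤ 1 := by
        rw [← hs]
        exact Finset.single_le_sum (fun j _ => ht j) (Finset.mem_univ i)
      have h3 : (1 : ℝ) / d ≤ 1 := by
        rw [div_le_one hd']
        exact_mod_cast hd
      have h4 : (0 : ℝ) < 1 / d := by positivity
      have h5 : 0 < d * 2 ^ d * δ := by positivity
      have h6 : 0 < d * (d * 2 ^ d * δ) := by positivity
      have h7 : 0 ≤ t i := ht i
      rw [abs_le]
      constructor <;> linarith

section Sphere

variable {E : Type*} [NormedAddCommGroup E] [InnerProductSpace ℝ E]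

lemma norm_sub_sq_of_unit {x y : E} (hx : ‖x‖ = 1) (hy : ‖y‖ = 1) :
    ‖x - y‖ ^ 2 = 2 - 2 * ⟪x, y⟫_ℝ := by
  rw [norm_sub_sq_real, hx, hy]
  ring

lemma cos_arccos_inner {x y : E} (hx : ‖x‖ = 1) (hy : ‖y‖ = 1) :
    Real.cos (Real.arccos ⟪x, y⟫_ℝ) = ⟪x, y⟫_ℝ := by
  have h := abs_real_inner_le_norm x y
  rw [hx, hy, mul_one, abs_le] at h
  exact Real.cos_arccos h.1 h.2

lemma norm_sub_le_arccos_inner {x y : E} (hx : ‖x‖ = 1) (hy : ‖y‖ = 1) :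
    ‖x - y‖ ≤ Real.arccos ⟪x, y⟫_ℝ := by
  refine abs_le_of_sq_le_sq' ?_ (Real.arccos_nonneg _) |>.2
  have h := Real.one_sub_sq_div_two_le_cos (x := Real.arccos ⟪x, y⟫_ℝ)
  rw [cos_arccos_inner hx hy] at h
  rw [norm_sub_sq_of_unit hx hy]
  linarith

lemma arccos_inner_le_norm_sub {x y : E} (hx : ‖x‖ = 1) (hy : ‖y‖ = 1) :
    Real.arccos ⟪x, y⟫_ℝ ≤ π / 2 * ‖x - y‖ := by
  have h1 := Real.arccos_nonneg ⟪x, y⟫_ℝ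
  have h2 := Real.arccos_le_pi ⟪x, y⟫_ℝ
  have h3 := Real.mul_le_sin (x := Real.arccos ⟪x, y⟫_ℝ / 2) (by linarith) (by linarith)
  have hsin : 0 ≤ Real.sin (Real.arccos ⟪x, y⟫_ℝ / 2) :=
    Real.sin_nonneg_of_nonneg_of_le_pi (by linarith) (by linarith)
  have h4 : ‖x - y‖ = 2 * Real.sin (Real.arccos ⟪x, y⟫_ℝ / 2) := by
    refine (sq_eq_sq₀ (norm_nonneg _) (mul_nonneg zero_le_two hsin)).1 ?_
    rw [norm_sub_sq_of_unit hx hy, mul_pow, Real.sin_sq_eq_half_sub, mul_div_cancel₀ _ two_ne_zero,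
      cos_arccos_inner hx hy]
    ring
  have hπ := Real.pi_pos
  rw [h4]
  calc Real.arccos ⟪x, y⟫_ℝ = π * (2 / π * (Real.arccos ⟪x, y⟫_ℝ / 2)) := by field_simp
    _ ≤ π * Real.sin (Real.arccos ⟪x, y⟫_ℝ / 2) := mul_le_mul_of_nonneg_left h3 hπ.le
    _ = _ := by ring

lemma norm_normalize_sub_le {x y : E} (hx : x ≠ 0) (hy : y ≠ 0) :
    ‖‖x‖⁻¹ • x - ‖y‖⁻¹ • y‖ ≤ 2 * ‖x - y‖ / ‖y‖ := by
  have hx' : 0 < ‖x‖ := norm_pos_iff.2 hx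
  have hy' : 0 < ‖y‖ := norm_pos_iff.2 hy
  rw [le_div_iff₀ hy']
  have h1 : ‖y‖ • (‖x‖⁻¹ • x - ‖y‖⁻¹ • y) = (‖y‖ - ‖x‖) • (‖x‖⁻¹ • x) + (x - y) := by
    rw [sub_smul, smul_sub, smul_inv_smul₀ hx'.ne', smul_inv_smul₀ hy'.ne']
    abel
  calc ‖‖x‖⁻¹ • x - ‖y‖⁻¹ • y‖ * ‖y‖ = ‖‖y‖ • (‖x‖⁻¹ • x - ‖y‖⁻¹ • y)‖ := by
        rw [norm_smul, norm_norm, mul_comm]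
    _ ≤ ‖(‖y‖ - ‖x‖) • (‖x‖⁻¹ • x)‖ + ‖x - y‖ := by
        rw [h1]
        exact norm_add_le _ _
    _ ≤ ‖x - y‖ + ‖x - y‖ := by
        refine add_le_add_left ?_ _
        rw [norm_smul, norm_smul, norm_inv, norm_norm, inv_mul_cancel₀ hx'.ne', mul_one,
          Real.norm_eq_abs, norm_sub_rev]
        exact abs_norm_sub_norm_le y x
    _ = 2 * ‖x - y‖ := by ring

end Sphere

lemma hausdorffMeasure_sphere_inter_ker (u : EuclideanSpace ℝ (Fin d) →ₗ[ℝ] ℝ) (hu : u ≠ 0) :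
    (Measure.hausdorffMeasure ((d : ℝ) - 1) : Measure (EuclideanSpace ℝ (Fin d)))
      (unitSphere d ∩ {x | u x = 0}) = 0 := by
  have hrank := Module.Dual.finrank_ker_add_one_of_ne_zero (f := u) hu
  rw [finrank_euclideanSpace_fin] at hrank
  have hdim : (d : ℝ) - 1 = (Module.finrank ℝ (LinearMap.ker u) : ℝ) := by
    have : ((Module.finrank ℝ (LinearMap.ker u) + 1 : ℕ) : ℝ) = d := by rw [hrank]
    push_cast at this
    linarith
  have himage : unitSphere d ∩ {x | u x = 0}
      = (Subtype.val : LinearMap.ker u → EuclideanSpace ℝ (Fin d)) '' Metric.sphere 0 1 := by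
    ext x
    simp [unitSphere, and_comm]
  rw [himage, hdim, isometry_subtype_coe.hausdorffMeasure_image (Or.inl (Nat.cast_nonneg _))]
  exact Measure.addHaar_sphere_of_ne_zero _ _ one_ne_zero

/-- The measure with density `N w` with respect to the surface measure. -/
def weightMeasure (N : ℕ) (w : EuclideanSpace ℝ (Fin d) → ℝ) :
    Measure (EuclideanSpace ℝ (Fin d)) :=
  (sphMeasure d).withDensity fun x => ENNReal.ofReal (N * w x)

lemma isFiniteMeasure_weightMeasure (N : ℕ) {w : EuclideanSpace ℝ (Fin d) → ℝ}
    (hw : Integrable w (sphMeasure d)) : IsFiniteMeasure (weightMeasure N w) :=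
  isFiniteMeasure_withDensity_ofReal (hw.const_mul (N : ℝ)).2

lemma measurableSet_unitSphere : MeasurableSet (unitSphere d) :=
  Metric.isClosed_sphere.measurableSet

lemma wMass_inter_unitSphere (w : EuclideanSpace ℝ (Fin d) → ℝ)
    (A : Set (EuclideanSpace ℝ (Fin d))) : wMass w (unitSphere d ∩ A) = wMass w A := by
  refine setIntegral_congr_set ?_
  filter_upwards [ae_restrict_mem (μ := Measure.hausdorffMeasure ((d : ℝ) - 1))
    (measurableSet_unitSphere (d := d))] with x hx
  exact propext ⟨fun h => h.2, fun h => ⟨hx, h⟩⟩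

lemma weightMeasure_real (N : ℕ) {w : EuclideanSpace ℝ (Fin d) → ℝ} (hw0 : ∀ x, 0 ≤ w x)
    (hw : Integrable w (sphMeasure d)) {A : Set (EuclideanSpace ℝ (Fin d))}
    (hA : MeasurableSet A) : (weightMeasure N w).real A = N * wMass w A := by
  rw [Measure.real, weightMeasure, withDensity_apply _ hA, wMass, ← integral_const_mul,
    integral_eq_lintegral_of_nonneg_ae (Filter.Eventually.of_forall fun x => by
      have := hw0 x
      positivity) (hw.const_mul (N : ℝ)).1.restrict]

lemma nullHyperplanes_weightMeasure (N : ℕ) (w : EuclideanSpace ℝ (Fin d) → ℝ) :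
    NullHyperplanes (weightMeasure N w) := fun u hu => by
  have hm : MeasurableSet {x | u x = 0} :=
    (isClosed_eq u.continuous_of_finiteDimensional continuous_const).measurableSet
  refine withDensity_absolutelyContinuous _ _ ?_
  rw [sphMeasure, Measure.restrict_apply hm, inter_comm]
  exact hausdorffMeasure_sphere_inter_ker u hu

lemma wMass_mono {w : EuclideanSpace ℝ (Fin d) → ℝ} (hw0 : ∀ x, 0 ≤ w x)
    (hw : Integrable w (sphMeasure d)) {A B : Set (EuclideanSpace ℝ (Fin d))} (h : A ⊆ B) :
    wMass w A ≤ wMass w B :=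
  setIntegral_mono_set hw.integrableOn (Filter.Eventually.of_forall hw0)
    (Filter.Eventually.of_forall h)

lemma StronglySep.mul_abs_le {ε : ℝ} {η : Fin d → EuclideanSpace ℝ (Fin d)}
    (h : StronglySep ε η) (t : Fin d → ℝ) (j : Fin d) :
    ε * |t j| ≤ ‖Fintype.linearCombination ℝ η t‖ := by
  rcases eq_or_ne (t j) 0 with h0 | h0
  · simp [h0]
  set y : EuclideanSpace ℝ (Fin d) := -∑ i ∈ Finset.univ.erase j, ((t j)⁻¹ * t i) • η i with hy
  have hmem : y ∈ Submodule.span ℝ (η '' {i | i ≠ j}) := by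
    refine Submodule.neg_mem _ (Submodule.sum_mem _ fun i hi => Submodule.smul_mem _ _ ?_)
    exact Submodule.subset_span ⟨i, Finset.ne_of_mem_erase hi, rfl⟩
  have heq : Fintype.linearCombination ℝ η t = t j • (η j - y) := by
    rw [Fintype.linearCombination_apply, ← Finset.add_sum_erase _ _ (Finset.mem_univ j), hy,
      sub_neg_eq_add, smul_add, Finset.smul_sum]
    congr 1
    refine Finset.sum_congr rfl fun i _ => ?_
    rw [smul_smul, mul_inv_cancel_left₀ h0]
  rw [heq, norm_smul, Real.norm_eq_abs, mul_comm]
  exact mul_le_mul_of_nonneg_left (h.2.2 j y hmem) (abs_nonneg _)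

lemma norm_linearCombination_le {η : Fin d → EuclideanSpace ℝ (Fin d)}
    (h : ∀ j, η j ∈ unitSphere d) (t : Fin d → ℝ) :
    ‖Fintype.linearCombination ℝ η t‖ ≤ ∑ i, |t i| := by
  rw [Fintype.linearCombination_apply]
  refine (norm_sum_le _ _).trans (Finset.sum_le_sum fun i _ => ?_)
  rw [norm_smul, mem_sphere_zero_iff_norm.1 (h i), mul_one, Real.norm_eq_abs]

lemma StronglySep.exists_equiv {ε : ℝ} (hε : 0 < ε) {η : Fin d → EuclideanSpace ℝ (Fin d)}
    (h : StronglySep ε η) : ∃ L : (Fin d → ℝ) ≃L[ℝ] EuclideanSpace ℝ (Fin d),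
      ∀ t, L t = Fintype.linearCombination ℝ η t := by
  have hinj : Function.Injective (Fintype.linearCombination ℝ η) := by
    rw [← LinearMap.ker_eq_bot, LinearMap.ker_eq_bot']
    intro t ht
    funext j
    have := h.mul_abs_le t j
    rw [ht, norm_zero] at this
    exact abs_nonpos_iff.1 (nonpos_of_mul_nonpos_right this hε)
  exact ⟨(LinearEquiv.ofInjectiveOfFinrankEq _ hinj (by simp)).toContinuousLinearEquiv,
    fun t => rfl⟩

lemma linearCombination_eq_normalize_mem {η : Fin d → EuclideanSpace ℝ (Fin d)}
    (p : Fin d → ℝ) (hp : ∀ i, 0 ≤ p i) (hs : ∑ i, p i = 1) :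
    ‖Fintype.linearCombination ℝ η p‖⁻¹ • Fintype.linearCombination ℝ η p ∈ geodSimplex η :=
  ⟨p, hp, hs, by rw [Fintype.linearCombination_apply]⟩

/-- The trace on the sphere of the image of `K` under `L`. -/
def sphTrace (L : (Fin d → ℝ) ≃L[ℝ] EuclideanSpace ℝ (Fin d)) (K : Set (Fin d → ℝ)) :
    Set (EuclideanSpace ℝ (Fin d)) :=
  unitSphere d ∩ L.symm ⁻¹' K

section Trace

variable {L : (Fin d → ℝ) ≃L[ℝ] EuclideanSpace ℝ (Fin d)} {K : Set (Fin d → ℝ)}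

lemma isClosed_sphTrace (hK : IsClosed K) : IsClosed (sphTrace L K) :=
  Metric.isClosed_sphere.inter (hK.preimage L.symm.continuous)

lemma IsConvCone.geoConvex_sphTrace (hK : IsConvCone K) : GeoConvex (sphTrace L K) := by
  rintro x hx y hy z ⟨hz, a, b, ha, hb, rfl⟩
  refine ⟨hz, ?_⟩
  have := hK _ hx.2 _ hy.2 a b ha hb
  rwa [← map_smul, ← map_smul, ← map_add] at this

lemma IsConvCone.smul_mem (hK : IsConvCone K) {x : Fin d → ℝ} (hx : x ∈ K) {a : ℝ}
    (ha : 0 ≤ a) : a • x ∈ K := by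
  have := hK x hx x hx a 0 ha le_rfl
  rwa [zero_smul, add_zero] at this

lemma measureReal_map_weightMeasure (N : ℕ) {w : EuclideanSpace ℝ (Fin d) → ℝ}
    (hw0 : ∀ x, 0 ≤ w x) (hw : Integrable w (sphMeasure d)) (hK : MeasurableSet K) :
    ((weightMeasure N w).map L.symm).real K = N * wMass w (sphTrace L K) := by
  have hL : Measurable L.symm := L.symm.continuous.measurable
  rw [Measure.real, Measure.map_apply hL hK, ← Measure.real, weightMeasure_real N hw0 hw (hL hK),
    sphTrace, wMass_inter_unitSphere]

lemma NullHyperplanes.map {μ : Measure (EuclideanSpace ℝ (Fin d))} (hμ : NullHyperplanes μ) :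
    NullHyperplanes (μ.map L.symm) := fun u hu => by
  have hm : MeasurableSet {t | u t = 0} :=
    (isClosed_eq u.continuous_of_finiteDimensional continuous_const).measurableSet
  rw [Measure.map_apply L.symm.continuous.measurable hm]
  refine hμ (u ∘ₗ (L.symm : EuclideanSpace ℝ (Fin d) →ₗ[ℝ] Fin d → ℝ)) fun h0 => hu ?_
  refine LinearMap.ext fun t => ?_
  simpa using LinearMap.congr_fun h0 (L t)

end Trace

lemma map_ne_zero_of_sum_eq_one (L : (Fin d → ℝ) ≃L[ℝ] EuclideanSpace ℝ (Fin d))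
    {p : Fin d → ℝ} (hs : ∑ i, p i = 1) : L p ≠ 0 := by
  rw [Ne, EmbeddingLike.map_eq_zero_iff]
  rintro rfl
  simp at hs

section Simplex

variable {ε : ℝ} {η : Fin d → EuclideanSpace ℝ (Fin d)}
  {L : (Fin d → ℝ) ≃L[ℝ] EuclideanSpace ℝ (Fin d)}

lemma sphTrace_orthant (hL : ∀ t, L t = Fintype.linearCombination ℝ η t) :
    sphTrace L {t | ∀ i, 0 ≤ t i} = geodSimplex η := by
  ext z
  constructor
  · rintro ⟨hz, ht⟩
    have ht' : ∀ i, 0 ≤ L.symm z i := ht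
    have hz1 : ‖z‖ = 1 := mem_sphere_zero_iff_norm.1 hz
    set t := L.symm z with htdef
    have hLt : L t = z := L.apply_symm_apply z
    have hτ : 0 < ∑ i, t i := by
      refine (Finset.sum_nonneg fun i _ => ht' i).lt_of_ne fun h0 => ?_
      have : t = 0 := by
        funext i
        exact (Finset.sum_eq_zero_iff_of_nonneg fun i _ => ht' i).1 h0.symm i (Finset.mem_univ i)
      rw [this, map_zero] at hLt
      rw [← hLt, norm_zero] at hz1
      exact zero_ne_one hz1
    set τ := ∑ i, t i with hτdef
    have hsum : ∑ i, (τ⁻¹ * t i) • η i = τ⁻¹ • z := by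
      rw [← hLt, hL, Fintype.linearCombination_apply, Finset.smul_sum]
      simp only [smul_smul]
    refine ⟨fun i => τ⁻¹ * t i, fun i => mul_nonneg (inv_nonneg.2 hτ.le) (ht' i), ?_, ?_⟩
    · rw [← Finset.mul_sum, inv_mul_cancel₀ hτ.ne']
    · rw [hsum, norm_smul, hz1, mul_one, Real.norm_of_nonneg (inv_nonneg.2 hτ.le), inv_inv,
        smul_inv_smul₀ hτ.ne']
  · rintro ⟨t, ht, hs, rfl⟩
    rw [← Fintype.linearCombination_apply, ← hL]
    have hne := map_ne_zero_of_sum_eq_one L hs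
    refine ⟨mem_sphere_zero_iff_norm.2 (norm_smul_inv_norm hne), fun i => ?_⟩
    rw [map_smul, L.symm_apply_apply]
    exact mul_nonneg (inv_nonneg.2 (norm_nonneg _)) (ht i)

variable {K : Set (Fin d → ℝ)} {p : Fin d → ℝ}

lemma StronglySep.cap_subset_sphTrace (hη : StronglySep ε η) (hε : 0 < ε)
    (hL : ∀ t, L t = Fintype.linearCombination ℝ η t) (hK : IsConvCone K)
    (hp : ∀ i, 0 ≤ p i) (hs : ∑ i, p i = 1) {δ : ℝ}
    (hbox : ∀ t : Fin d → ℝ, (∀ i, |t i - p i| ≤ δ) → t ∈ K) :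
    cap (‖L p‖⁻¹ • L p) (ε * δ) ⊆ sphTrace L K := by
  rintro y ⟨hy, hdist⟩
  have hne := map_ne_zero_of_sum_eq_one L hs
  have hpos := norm_pos_iff.2 hne
  have hchord := (norm_sub_le_arccos_inner (norm_smul_inv_norm hne)
    (mem_sphere_zero_iff_norm.1 hy)).trans hdist
  have hle : ‖L p‖ ≤ 1 := by
    rw [hL, ← hs]
    refine (norm_linearCombination_le hη.2.1 p).trans_eq (Finset.sum_congr rfl fun i _ => ?_)
    exact abs_of_nonneg (hp i)
  have hmem : ‖L p‖ • L.symm y ∈ K := by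
    refine hbox _ fun i => le_of_mul_le_mul_left ?_ hε
    have h1 := hη.mul_abs_le (‖L p‖ • L.symm y - p) i
    rw [← hL, map_sub, map_smul, L.apply_symm_apply] at h1
    refine h1.trans ?_
    calc ‖‖L p‖ • y - L p‖ = ‖‖L p‖ • (y - ‖L p‖⁻¹ • L p)‖ := by
          rw [smul_sub, smul_inv_smul₀ hpos.ne']
      _ = ‖L p‖ * ‖‖L p‖⁻¹ • L p - y‖ := by rw [norm_smul, norm_norm, norm_sub_rev]
      _ ≤ ‖‖L p‖⁻¹ • L p - y‖ := mul_le_of_le_one_left (norm_nonneg _) hle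
      _ ≤ ε * δ := hchord
  refine ⟨hy, ?_⟩
  have := hK.smul_mem hmem (inv_nonneg.2 hpos.le)
  rwa [inv_smul_smul₀ hpos.ne'] at this

lemma StronglySep.div_le_norm (hη : StronglySep ε η) (hε : 0 < ε) (hd : 0 < d)
    (hL : ∀ t, L t = Fintype.linearCombination ℝ η t) (hs : ∑ i, p i = 1) : ε / d ≤ ‖L p‖ := by
  have hd' : (0 : ℝ) < d := by exact_mod_cast hd
  have : Nonempty (Fin d) := ⟨⟨0, hd⟩⟩
  obtain ⟨i, -, hi⟩ := Finset.exists_le_of_sum_le (s := Finset.univ) (f := fun _ => (1 : ℝ) / d)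
    (g := p) Finset.univ_nonempty (by simp [hs, hd'.ne'])
  calc ε / d = ε * (1 / d) := by ring
    _ ≤ ε * |p i| := mul_le_mul_of_nonneg_left (hi.trans (le_abs_self _)) hε.le
    _ ≤ ‖L p‖ := by rw [hL]; exact hη.mul_abs_le p i

lemma StronglySep.sphTrace_subset_cap (hη : StronglySep ε η) (hε : 0 < ε) (hd : 0 < d)
    (hL : ∀ t, L t = Fintype.linearCombination ℝ η t) (hK : IsConvCone K)
    (hK0 : ∀ t ∈ K, ∀ i, 0 ≤ t i) (hs : ∑ i, p i = 1) {Λ : ℝ}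
    (hout : ∀ t ∈ K, ∑ i, t i = 1 → ∀ i, |t i - p i| ≤ Λ) :
    sphTrace L K ⊆ cap (‖L p‖⁻¹ • L p) (π * d ^ 2 * Λ / ε) := by
  rintro y ⟨hy, hyK⟩
  have hd' : (0 : ℝ) < d := by exact_mod_cast hd
  have hy1 : ‖y‖ = 1 := mem_sphere_zero_iff_norm.1 hy
  obtain ⟨q, hq, hqs, hyq⟩ : y ∈ geodSimplex η := by
    rw [← sphTrace_orthant hL]
    exact ⟨hy, hK0 _ hyK⟩
  rw [← Fintype.linearCombination_apply, ← hL] at hyq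
  have hqne := map_ne_zero_of_sum_eq_one L hqs
  have hne := map_ne_zero_of_sum_eq_one L hs
  have hqK : q ∈ K := by
    have := hK.smul_mem hyK (norm_nonneg (L q))
    rwa [hyq, map_smul, L.symm_apply_apply, smul_inv_smul₀ (norm_ne_zero_iff.2 hqne)] at this
  have hdiff : ‖L q - L p‖ ≤ d * Λ := by
    rw [← map_sub, hL]
    refine (norm_linearCombination_le hη.2.1 _).trans
      ((Finset.sum_le_sum fun i _ => hout q hqK hqs i).trans_eq ?_)
    simp
  have hchord : ‖‖L p‖⁻¹ • L p - y‖ ≤ 2 * (d * Λ) / (ε / d) := by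
    rw [norm_sub_rev, hyq]
    exact (norm_normalize_sub_le hqne hne).trans (div_le_div₀
      (mul_nonneg zero_le_two ((norm_nonneg _).trans hdiff)) (by linarith) (by positivity)
      (hη.div_le_norm hε hd hL hs))
  refine ⟨hy, (arccos_inner_le_norm_sub (norm_smul_inv_norm hne) hy1).trans ?_⟩
  refine (mul_le_mul_of_nonneg_left hchord (by positivity)).trans_eq ?_
  field_simp

end Simplex

lemma sphInterior_inter_eq_empty {w : EuclideanSpace ℝ (Fin d) → ℝ} (hw0 : ∀ x, 0 ≤ w x)
    (hw : Integrable w (sphMeasure d))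
    (hcap : ∀ x ∈ unitSphere d, ∀ ρ : ℝ, 0 < ρ → 0 < wMass w (cap x ρ))
    {A B : Set (EuclideanSpace ℝ (Fin d))} (hA : A ⊆ unitSphere d) (h : wMass w (A ∩ B) = 0) :
    sphInterior A ∩ sphInterior B = ∅ := by
  refine eq_empty_of_forall_notMem ?_
  rintro x ⟨⟨hxA, e₁, he₁, h₁⟩, ⟨-, e₂, he₂, h₂⟩⟩
  have hpos : 0 < min e₁ e₂ / 2 := by positivity
  have hsub : cap x (min e₁ e₂ / 2) ⊆ A ∩ B := by
    rintro y ⟨hy, hdist⟩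
    have hlt : dist y x < min e₁ e₂ := by
      rw [dist_comm, dist_eq_norm]
      have := (norm_sub_le_arccos_inner (mem_sphere_zero_iff_norm.1 (hA hxA))
        (mem_sphere_zero_iff_norm.1 hy)).trans hdist
      linarith
    exact ⟨h₁ ⟨hlt.trans_le (min_le_left _ _), hy⟩, h₂ ⟨hlt.trans_le (min_le_right _ _), hy⟩⟩
  have := hcap x (hA hxA) _ hpos
  linarith [wMass_mono hw0 hw hsub]

/-- Regular convex partitions of a geodesic simplex spanned by a
strongly `ε`-separated set. -/
theorem geodesic_simplex_convex_partition (d : ℕ) (hd : 3 ≤ d) (ε : ℝ)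
    (hε : ε ∈ Set.Ioo (0 : ℝ) 1) :
    ∃ c c' : ℝ, 0 < c ∧ 0 < c' ∧
      ∀ η : Fin d → EuclideanSpace ℝ (Fin d), StronglySep ε η →
      ∀ w : EuclideanSpace ℝ (Fin d) → ℝ,
        (∀ x, 0 ≤ w x) →
        Integrable w (sphMeasure d) →
        wMass w (unitSphere d) = 1 →
        (∀ x ∈ unitSphere d, ∀ ρ : ℝ, 0 < ρ → 0 < wMass w (cap x ρ)) →
      ∀ r : ℝ, r ∈ Set.Ioo (0 : ℝ) 1 →
      ∀ N : ℕ, 0 < N →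
        (∀ x ∈ unitSphere d, 1 / (N : ℝ) ≤ wMass w (cap x r)) →
        (∃ k : ℕ, 0 < k ∧ (N : ℝ) * wMass w (geodSimplex η) = (k : ℝ)) →
        ∃ (n : ℕ) (R : Fin n → Set (EuclideanSpace ℝ (Fin d)))
          (xs : Fin n → EuclideanSpace ℝ (Fin d)),
          (∀ j, IsClosed (R j)) ∧
          (∀ j, GeoConvex (R j)) ∧
          (⋃ j, R j) = geodSimplex η ∧
          (∀ i j, i ≠ j → sphInterior (R i) ∩ sphInterior (R j) = ∅) ∧
          ∀ j, xs j ∈ geodSimplex η ∧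
            (∃ k : ℕ, 0 < k ∧ (N : ℝ) * wMass w (R j) = (k : ℝ)) ∧
            cap (xs j) (c * r) ⊆ R j ∧ R j ⊆ cap (xs j) (c' * r) := by
  have hd0 : 0 < d := by omega
  have hd' : (1 : ℝ) ≤ d := by exact_mod_cast hd0
  obtain ⟨hε0, hε1⟩ := hε
  set D : ℝ := 6 * d * 2 ^ d * (2 * d + 1) with hD
  have hD0 : 0 < D := by positivity
  refine ⟨ε / d, π * d ^ 2 * D / ε ^ 2, by positivity, by positivity, ?_⟩
  rintro η hη w hw0 hw - hcap r ⟨hr0, hr1⟩ N hN hmass hint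
  have hN' : (0 : ℝ) < N := by exact_mod_cast hN
  obtain ⟨L, hL⟩ := hη.exists_equiv hε0
  have hfin := isFiniteMeasure_weightMeasure N hw
  set ν := (weightMeasure N w).map L.symm with hν
  have hνfin : IsFiniteMeasure ν := by rw [hν]; infer_instance
  have hνK : ∀ K, MeasurableSet K → ν.real K = N * wMass w (sphTrace L K) := fun K hK =>
    measureReal_map_weightMeasure N hw0 hw hK
  have horth : MeasurableSet {t : Fin d → ℝ | ∀ i, 0 ≤ t i} := by
    simp only [ofPred_forall]
    exact MeasurableSet.iInter fun i => measurableSet_le measurable_const (measurable_pi_apply i)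
  have hbox : BoxMass ν (r / ε) := by
    intro p hp hs K hKc hK hpK
    have hsub := hη.cap_subset_sphTrace hε0 hL hK hp hs hpK
    rw [mul_div_cancel₀ _ hε0.ne'] at hsub
    have hpS : ‖L p‖⁻¹ • L p ∈ unitSphere d :=
      mem_sphere_zero_iff_norm.2 (norm_smul_inv_norm (map_ne_zero_of_sum_eq_one L hs))
    rw [hνK K hKc.measurableSet]
    have := (hmass _ hpS).trans (wMass_mono hw0 hw hsub)
    rw [div_le_iff₀ hN'] at this
    linarith
  obtain ⟨F, hgood, hunion, hnull⟩ := hasGoodPartition_orthant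
    (nullHyperplanes_weightMeasure N w).map hd0 (div_pos hr0 hε0) hbox
    (by rw [hνK _ horth, sphTrace_orthant hL]; exact hint)
  choose! hclosed hcone hm p hp hs hin hout using hgood
  have hK0 : ∀ K ∈ F, ∀ t ∈ K, ∀ i, 0 ≤ t i := fun K hK t ht => by
    have : t ∈ ⋃₀ (F : Set (Set (Fin d → ℝ))) := ⟨K, hK, ht⟩
    rw [hunion] at this
    exact this
  let e := F.equivFin.symm
  refine ⟨F.card, fun j => sphTrace L (e j), fun j => ‖L (p (e j))‖⁻¹ • L (p (e j)),
    fun j => isClosed_sphTrace (hclosed _ (e j).2),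
    fun j => (hcone _ (e j).2).geoConvex_sphTrace, ?_, ?_, ?_⟩
  · rw [← sphTrace_orthant hL, ← hunion, sphTrace, sUnion_eq_iUnion, preimage_iUnion, inter_iUnion]
    exact e.surjective.iUnion_comp fun K : F => sphTrace L (K : Set (Fin d → ℝ))
  · intro i j hij
    refine sphInterior_inter_eq_empty hw0 hw hcap inter_subset_left ?_
    have hne : (e i : Set (Fin d → ℝ)) ≠ e j := fun h => hij (e.injective (Subtype.ext h))
    have h1 := hνK _ ((hclosed _ (e i).2).inter (hclosed _ (e j).2)).measurableSet
    rw [Measure.real, hnull _ (e i).2 _ (e j).2 hne, ENNReal.toReal_zero] at h1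
    have h2 : sphTrace L (e i) ∩ sphTrace L (e j) = sphTrace L ((e i : Set (Fin d → ℝ)) ∩ e j) := by
      simp only [sphTrace, preimage_inter]
      exact (inter_inter_distrib_left _ _ _).symm
    rw [h2]
    exact (mul_eq_zero.1 h1.symm).resolve_left hN'.ne'
  · intro j
    have hj := (e j).2
    refine ⟨?_, ?_, ?_, ?_⟩
    · show ‖L (p (e j))‖⁻¹ • L (p (e j)) ∈ geodSimplex η
      rw [hL]
      exact linearCombination_eq_normalize_mem _ (hp _ hj) (hs _ hj)
    · rw [← hνK _ (hclosed _ hj).measurableSet]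
      exact hm _ hj
    · have hρ : r / d ≤ min (r / ε) (1 / d) :=
        le_min (div_le_div_of_nonneg_left hr0.le hε0 (by linarith))
          (div_le_div_of_nonneg_right hr1.le (by linarith))
      have := hη.cap_subset_sphTrace hε0 hL (hcone _ hj) (hp _ hj) (hs _ hj)
        fun t ht => hin _ hj t fun i => (ht i).trans hρ
      rwa [mul_div_assoc', ← div_mul_eq_mul_div] at this
    · have := hη.sphTrace_subset_cap hε0 hd0 hL (hcone _ hj) (hK0 _ hj) (hs _ hj) (hout _ hj)
      convert this using 2
      field_simp
      rw [hD]
      ring
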